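/- arXiv:1603.05576 — 2 statements merged into one kernel-verified Lean document; each statement's English description precedes it below -/
import Mathlib

section
/- Let 0 < ρ < 1, let m₂ = ∑_{a∈Λ} D_{Λ,√ρ}(a)·a² be the second moment of the discrete Gaussian D_{Λ,√ρ}, and let h(f_{X̄,Ȳ}) = −∫_{ℝ²} f_{X̄,Ȳ} ln f_{X̄,Ȳ} dx dy be the differential entropy of the mixture density (assumed finite). Then the Kullback–Leibler divergence satisfies the exact identity D(f_{X̄,Ȳ} ‖ f_{X,Y}) = ln(2π√(1−ρ²)) + (1 + m₂)/(1 + ρ) − h(f_{X̄,Ȳ}). -/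
open Real

/-- The centered Gaussian density with standard deviation `σ`. -/
noncomputable def gpdf (σ x : ℝ) : ℝ :=
  (1 / (Real.sqrt (2 * Real.pi) * σ)) * Real.exp (-(x ^ 2) / (2 * σ ^ 2))

/-- The discrete Gaussian distribution over the lattice `Λ = bℤ` with parameter `σ`,
evaluated at the lattice point `b * k`. -/
noncomputable def dgauss (b σ : ℝ) (k : ℤ) : ℝ :=
  gpdf σ (b * k) / ∑' j : ℤ, gpdf σ (b * j)

/-- The flatness factor of the lattice `Λ = bℤ` at parameter `σ`. -/
noncomputable def flatness (b σ : ℝ) : ℝ :=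
  ⨆ x : ℝ, |b * (∑' k : ℤ, gpdf σ (x - b * k)) - 1|

/-- The bivariate Gaussian density with unit variances and correlation `ρ`. -/
noncomputable def fXY (ρ x y : ℝ) : ℝ :=
  (1 / (2 * Real.pi * Real.sqrt (1 - ρ ^ 2))) *
    Real.exp (-(x ^ 2 + y ^ 2 - 2 * ρ * x * y) / (2 * (1 - ρ ^ 2)))

/-- The density of `(W̄ + √(1-ρ)N₁, W̄ + √(1-ρ)N₂)` where `W̄ ~ D_{Λ,√ρ}`, `Λ = bℤ`. -/
noncomputable def fXbarYbar (ρ b x y : ℝ) : ℝ :=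
  ∑' k : ℤ, dgauss b (Real.sqrt ρ) k * gpdf (Real.sqrt (1 - ρ)) (x - b * k) *
    gpdf (Real.sqrt (1 - ρ)) (y - b * k)

open MeasureTheory ProbabilityTheory

lemma gpdf_nonneg {s : ℝ} (hs : 0 < s) (x : ℝ) : 0 ≤ gpdf s x := by
  unfold gpdf
  positivity

lemma gpdf_pos {s : ℝ} (hs : 0 < s) (x : ℝ) : 0 < gpdf s x := by
  unfold gpdf
  positivity

lemma gpdf_sub_eq_gaussianPDFReal {s : ℝ} (hs : 0 < s) (c x : ℝ) :
    gpdf s (x - c) = gaussianPDFReal c (s ^ 2).toNNReal x := by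
  rw [gpdf, gaussianPDFReal, Real.coe_toNNReal _ (sq_nonneg s), Real.sqrt_mul (by positivity) (s ^ 2),
    Real.sqrt_sq hs.le, one_div]

lemma integrable_gpdf_sub_mul_pow {s : ℝ} (hs : 0 < s) (c : ℝ) (n : ℕ) :
    Integrable fun x : ℝ => gpdf s (x - c) * x ^ n := by
  have hv : (s ^ 2).toNNReal ≠ 0 := (Real.toNNReal_pos.2 (pow_pos hs 2)).ne'
  have h : Integrable (fun x : ℝ => x ^ n) (gaussianReal c (s ^ 2).toNNReal) := by
    have h := (memLp_id_gaussianReal (μ := c) (v := (s ^ 2).toNNReal) n).integrable_norm_pow'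
    refine h.mono (by fun_prop) (ae_of_all _ fun x => ?_)
    simp
  rw [gaussianReal_of_var_ne_zero c hv,
    integrable_withDensity_iff_integrable_smul' (measurable_gaussianPDF _ _)
      (ae_of_all _ fun _ => gaussianPDF_lt_top)] at h
  simpa [gpdf_sub_eq_gaussianPDFReal hs] using h

lemma integral_gpdf_sub_mul {s : ℝ} (hs : 0 < s) (c : ℝ) (g : ℝ → ℝ) :
    ∫ x : ℝ, gpdf s (x - c) * g x = ∫ x, g x ∂(gaussianReal c (s ^ 2).toNNReal) := by
  have hv : (s ^ 2).toNNReal ≠ 0 := (Real.toNNReal_pos.2 (pow_pos hs 2)).ne'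
  rw [integral_gaussianReal_eq_integral_smul hv]
  simp [gpdf_sub_eq_gaussianPDFReal hs]

lemma integral_gpdf_sub {s : ℝ} (hs : 0 < s) (c : ℝ) :
    ∫ x : ℝ, gpdf s (x - c) = 1 := by
  simpa using integral_gpdf_sub_mul hs c fun _ => 1

lemma integral_gpdf_sub_mul_self {s : ℝ} (hs : 0 < s) (c : ℝ) :
    ∫ x : ℝ, gpdf s (x - c) * x = c := by
  rw [integral_gpdf_sub_mul hs c fun x => x, integral_id_gaussianReal]

lemma integral_gpdf_sub_mul_sq {s : ℝ} (hs : 0 < s) (c : ℝ) :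
    ∫ x : ℝ, gpdf s (x - c) * x ^ 2 = c ^ 2 + s ^ 2 := by
  rw [integral_gpdf_sub_mul hs c fun x => x ^ 2]
  have h := variance_eq_sub
    (memLp_id_gaussianReal (μ := c) (v := (s ^ 2).toNNReal) 2)
  rw [variance_id_gaussianReal] at h
  simp only [Pi.pow_apply, id_eq, integral_id_gaussianReal, Real.coe_toNNReal _ (sq_nonneg s)] at h
  linarith

lemma integrable_gpdf_mul_gpdf {s : ℝ} (hs : 0 < s) (c : ℝ) :
    Integrable fun p : ℝ × ℝ => gpdf s (p.1 - c) * gpdf s (p.2 - c) := by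
  have h : Integrable fun x : ℝ => gpdf s (x - c) := by
    simpa using integrable_gpdf_sub_mul_pow hs c 0
  exact h.mul_prod h

lemma integral_gpdf_mul_gpdf {s : ℝ} (hs : 0 < s) (c : ℝ) :
    ∫ p : ℝ × ℝ, gpdf s (p.1 - c) * gpdf s (p.2 - c) = 1 := by
  have h := integral_prod_mul (μ := (volume : Measure ℝ)) (ν := (volume : Measure ℝ))
    (fun x : ℝ => gpdf s (x - c)) fun x : ℝ => gpdf s (x - c)
  rw [integral_gpdf_sub hs, one_mul] at h
  exact h

lemma gpdf_mul_gpdf_mul_quadratic (s c ρ : ℝ) (p : ℝ × ℝ) :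
    gpdf s (p.1 - c) * gpdf s (p.2 - c) * (p.1 ^ 2 + p.2 ^ 2 - 2 * ρ * p.1 * p.2) =
      gpdf s (p.1 - c) * p.1 ^ 2 * gpdf s (p.2 - c) +
        gpdf s (p.1 - c) * (gpdf s (p.2 - c) * p.2 ^ 2) -
        2 * ρ * (gpdf s (p.1 - c) * p.1 * (gpdf s (p.2 - c) * p.2)) := by
  ring

lemma integrable_and_integral_gpdf_mul_gpdf_mul_quadratic {s : ℝ} (hs : 0 < s) (c ρ : ℝ) :
    Integrable (fun p : ℝ × ℝ => gpdf s (p.1 - c) * gpdf s (p.2 - c) *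
        (p.1 ^ 2 + p.2 ^ 2 - 2 * ρ * p.1 * p.2)) ∧
      ∫ p : ℝ × ℝ, gpdf s (p.1 - c) * gpdf s (p.2 - c) *
        (p.1 ^ 2 + p.2 ^ 2 - 2 * ρ * p.1 * p.2) = 2 * (1 - ρ) * c ^ 2 + 2 * s ^ 2 := by
  have h0 : Integrable fun x : ℝ => gpdf s (x - c) := by
    simpa using integrable_gpdf_sub_mul_pow hs c 0
  have h1 : Integrable fun x : ℝ => gpdf s (x - c) * x := by
    simpa using integrable_gpdf_sub_mul_pow hs c 1
  have h2 := integrable_gpdf_sub_mul_pow hs c 2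
  have i1 : Integrable fun p : ℝ × ℝ => gpdf s (p.1 - c) * p.1 ^ 2 * gpdf s (p.2 - c) :=
    h2.mul_prod h0
  have i2 : Integrable fun p : ℝ × ℝ => gpdf s (p.1 - c) * (gpdf s (p.2 - c) * p.2 ^ 2) :=
    h0.mul_prod h2
  have i3 : Integrable fun p : ℝ × ℝ =>
      2 * ρ * (gpdf s (p.1 - c) * p.1 * (gpdf s (p.2 - c) * p.2)) :=
    (h1.mul_prod h1).const_mul _
  have i12 : Integrable fun p : ℝ × ℝ => gpdf s (p.1 - c) * p.1 ^ 2 * gpdf s (p.2 - c) +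
      gpdf s (p.1 - c) * (gpdf s (p.2 - c) * p.2 ^ 2) := i1.add i2
  have e1 : ∫ p : ℝ × ℝ, gpdf s (p.1 - c) * p.1 ^ 2 * gpdf s (p.2 - c) = c ^ 2 + s ^ 2 := by
    have h := integral_prod_mul (μ := (volume : Measure ℝ)) (ν := (volume : Measure ℝ))
      (fun x : ℝ => gpdf s (x - c) * x ^ 2) fun x : ℝ => gpdf s (x - c)
    rw [integral_gpdf_sub hs, integral_gpdf_sub_mul_sq hs, mul_one] at h
    exact h
  have e2 : ∫ p : ℝ × ℝ, gpdf s (p.1 - c) * (gpdf s (p.2 - c) * p.2 ^ 2) = c ^ 2 + s ^ 2 := by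
    have h := integral_prod_mul (μ := (volume : Measure ℝ)) (ν := (volume : Measure ℝ))
      (fun x : ℝ => gpdf s (x - c)) fun x : ℝ => gpdf s (x - c) * x ^ 2
    rw [integral_gpdf_sub hs, integral_gpdf_sub_mul_sq hs, one_mul] at h
    exact h
  have e3 : ∫ p : ℝ × ℝ, gpdf s (p.1 - c) * p.1 * (gpdf s (p.2 - c) * p.2) = c * c := by
    have h := integral_prod_mul (μ := (volume : Measure ℝ)) (ν := (volume : Measure ℝ))
      (fun x : ℝ => gpdf s (x - c) * x) fun x : ℝ => gpdf s (x - c) * x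
    rw [integral_gpdf_sub_mul_self hs] at h
    exact h
  simp only [gpdf_mul_gpdf_mul_quadratic]
  refine ⟨i12.sub i3, ?_⟩
  rw [integral_sub i12 i3, integral_add i1 i2, integral_const_mul, e1, e2, e3]
  ring

lemma summable_pow_mul_gpdf {b s : ℝ} (hb : 0 < b) (hs : 0 < s) (n : ℕ) :
    Summable fun k : ℤ => |(k : ℝ)| ^ n * gpdf s (b * k) := by
  have hT : 0 < b ^ 2 / (2 * π * s ^ 2) := by positivity
  refine ((summable_pow_mul_jacobiTheta₂_term_bound 0 hT n).mul_left
    (1 / (Real.sqrt (2 * Real.pi) * s))).congr fun k => ?_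
  rw [gpdf, Int.cast_abs, mul_left_comm]
  congr 3
  field_simp
  ring

lemma summable_dgauss {b s : ℝ} (hb : 0 < b) (hs : 0 < s) : Summable (dgauss b s) := by
  have h : Summable fun k : ℤ => gpdf s (b * k) := by
    simpa using summable_pow_mul_gpdf hb hs 0
  exact h.div_const _

lemma summable_dgauss_mul_sq {b s : ℝ} (hb : 0 < b) (hs : 0 < s) :
    Summable fun k : ℤ => dgauss b s k * (b * k) ^ 2 := by
  refine ((summable_pow_mul_gpdf hb hs 2).mul_left
    (b ^ 2 / ∑' j : ℤ, gpdf s (b * j))).congr fun k => ?_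
  rw [dgauss, sq_abs]
  ring

lemma dgauss_nonneg {s : ℝ} (hs : 0 < s) (b : ℝ) (k : ℤ) : 0 ≤ dgauss b s k :=
  div_nonneg (gpdf_nonneg hs _) (tsum_nonneg fun _ => gpdf_nonneg hs _)

lemma tsum_dgauss {b s : ℝ} (hb : 0 < b) (hs : 0 < s) : ∑' k : ℤ, dgauss b s k = 1 := by
  have h : Summable fun k : ℤ => gpdf s (b * k) := by
    simpa using summable_pow_mul_gpdf hb hs 0
  have hpos : 0 < ∑' j : ℤ, gpdf s (b * j) :=
    h.tsum_pos (fun _ => gpdf_nonneg hs _) 0 (gpdf_pos hs _)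
  simp only [dgauss]
  rw [tsum_div_const, div_self hpos.ne']

lemma integral_fXbarYbar {ρ b : ℝ} (hb : 0 < b) (hρ0 : 0 < ρ) (hρ1 : ρ < 1) :
    ∫ p : ℝ × ℝ, fXbarYbar ρ b p.1 p.2 = 1 := by
  have hr : 0 < √ρ := Real.sqrt_pos.2 hρ0
  have hs : 0 < √(1 - ρ) := Real.sqrt_pos.2 (sub_pos.2 hρ1)
  have hint (k : ℤ) : ∫ p : ℝ × ℝ, dgauss b (√ρ) k * gpdf (√(1 - ρ)) (p.1 - b * k) *
      gpdf (√(1 - ρ)) (p.2 - b * k) = dgauss b (√ρ) k := by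
    simp only [mul_assoc]
    rw [integral_const_mul, integral_gpdf_mul_gpdf hs, mul_one]
  have h := hasSum_integral_of_summable_integral_norm (μ := (volume : Measure (ℝ × ℝ)))
    (F := fun (k : ℤ) p => dgauss b (√ρ) k * gpdf (√(1 - ρ)) (p.1 - b * k) *
      gpdf (√(1 - ρ)) (p.2 - b * k))
    (fun k => by
      simp only [mul_assoc]
      exact (integrable_gpdf_mul_gpdf hs _).const_mul _)
    (by
      refine (summable_dgauss hb hr).congr fun k => ?_
      refine (hint k).symm.trans ?_
      refine integral_congr_ae (ae_of_all _ fun p => (Real.norm_of_nonneg ?_).symm)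
      exact mul_nonneg (mul_nonneg (dgauss_nonneg hr _ _) (gpdf_nonneg hs _)) (gpdf_nonneg hs _))
  simp only [hint] at h
  exact h.tsum_eq.symm.trans (tsum_dgauss hb hr)

lemma integral_fXbarYbar_mul_quadratic {ρ b : ℝ} (hb : 0 < b) (hρ0 : 0 < ρ) (hρ1 : ρ < 1) :
    ∫ p : ℝ × ℝ, fXbarYbar ρ b p.1 p.2 * (p.1 ^ 2 + p.2 ^ 2 - 2 * ρ * p.1 * p.2) =
      2 * (1 - ρ) * (1 + ∑' k : ℤ, dgauss b (√ρ) k * (b * k) ^ 2) := by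
  have hr : 0 < √ρ := Real.sqrt_pos.2 hρ0
  have hs : 0 < √(1 - ρ) := Real.sqrt_pos.2 (sub_pos.2 hρ1)
  have hss : √(1 - ρ) ^ 2 = 1 - ρ := Real.sq_sqrt (sub_pos.2 hρ1).le
  have hQ (p : ℝ × ℝ) : 0 ≤ p.1 ^ 2 + p.2 ^ 2 - 2 * ρ * p.1 * p.2 := by
    nlinarith [mul_nonneg hρ0.le (sq_nonneg (p.1 - p.2)),
      mul_nonneg (sub_pos.2 hρ1).le (add_nonneg (sq_nonneg p.1) (sq_nonneg p.2))]
  have hint (k : ℤ) : ∫ p : ℝ × ℝ, dgauss b (√ρ) k * (gpdf (√(1 - ρ)) (p.1 - b * k) *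
      gpdf (√(1 - ρ)) (p.2 - b * k) * (p.1 ^ 2 + p.2 ^ 2 - 2 * ρ * p.1 * p.2)) =
      2 * (1 - ρ) * (dgauss b (√ρ) k + dgauss b (√ρ) k * (b * k) ^ 2) := by
    rw [integral_const_mul, (integrable_and_integral_gpdf_mul_gpdf_mul_quadratic hs _ ρ).2, hss]
    ring
  have hsum := (summable_dgauss hb hr).add (summable_dgauss_mul_sq hb hr)
  have h := hasSum_integral_of_summable_integral_norm (μ := (volume : Measure (ℝ × ℝ)))
    (F := fun (k : ℤ) p => dgauss b (√ρ) k * (gpdf (√(1 - ρ)) (p.1 - b * k) *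
      gpdf (√(1 - ρ)) (p.2 - b * k) * (p.1 ^ 2 + p.2 ^ 2 - 2 * ρ * p.1 * p.2)))
    (fun k => (integrable_and_integral_gpdf_mul_gpdf_mul_quadratic hs _ ρ).1.const_mul _)
    (by
      refine (hsum.mul_left (2 * (1 - ρ))).congr fun k => ?_
      refine (hint k).symm.trans ?_
      refine integral_congr_ae (ae_of_all _ fun p => (Real.norm_of_nonneg ?_).symm)
      exact mul_nonneg (dgauss_nonneg hr _ _)
        (mul_nonneg (mul_nonneg (gpdf_nonneg hs _) (gpdf_nonneg hs _)) (hQ p)))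
  simp only [hint] at h
  have h' := h.tsum_eq
  rw [tsum_mul_left, (summable_dgauss hb hr).tsum_add (summable_dgauss_mul_sq hb hr),
    tsum_dgauss hb hr] at h'
  rw [h']
  refine integral_congr_ae (ae_of_all _ fun p => ?_)
  simp only [fXbarYbar]
  rw [← tsum_mul_right]
  simp only [mul_assoc]

lemma log_fXY {ρ : ℝ} (hρ0 : 0 < ρ) (hρ1 : ρ < 1) (x y : ℝ) :
    Real.log (fXY ρ x y) = -Real.log (2 * π * √(1 - ρ ^ 2)) -
      (x ^ 2 + y ^ 2 - 2 * ρ * x * y) / (2 * (1 - ρ ^ 2)) := by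
  have hpos : 0 < √(1 - ρ ^ 2) := Real.sqrt_pos.2 (by nlinarith)
  rw [fXY, Real.log_mul (by positivity) (Real.exp_pos _).ne', Real.log_exp, one_div, Real.log_inv]
  ring

lemma fXY_pos {ρ : ℝ} (hρ0 : 0 < ρ) (hρ1 : ρ < 1) (x y : ℝ) : 0 < fXY ρ x y := by
  have hpos : 0 < √(1 - ρ ^ 2) := Real.sqrt_pos.2 (by nlinarith)
  unfold fXY
  positivity

/-- with `m₂` the second moment of the discrete Gaussian `D_{Λ,√ρ}` and the
differential entropy of the mixture density assumed finite (integrable entropy integrand),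
the Kullback–Leibler divergence satisfies the exact identity
`D(f_{X̄,Ȳ} ‖ f_{X,Y}) = ln(2π√(1-ρ²)) + (1 + m₂)/(1 + ρ) − h(f_{X̄,Ȳ})`. -/
theorem kl_divergence_identity (ρ b : ℝ) (hb : 0 < b) (hρ0 : 0 < ρ) (hρ1 : ρ < 1)
    (hEnt : MeasureTheory.Integrable
      (fun p : ℝ × ℝ => fXbarYbar ρ b p.1 p.2 * Real.log (fXbarYbar ρ b p.1 p.2))) :
    ∫ p : ℝ × ℝ, fXbarYbar ρ b p.1 p.2 * Real.log (fXbarYbar ρ b p.1 p.2 / fXY ρ p.1 p.2) =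
      Real.log (2 * Real.pi * Real.sqrt (1 - ρ ^ 2)) +
        (1 + ∑' k : ℤ, dgauss b (Real.sqrt ρ) k * (b * k) ^ 2) / (1 + ρ) -
        (-∫ p : ℝ × ℝ, fXbarYbar ρ b p.1 p.2 * Real.log (fXbarYbar ρ b p.1 p.2)) := by
  have hm : 0 ≤ ∑' k : ℤ, dgauss b (√ρ) k * (b * k) ^ 2 :=
    tsum_nonneg fun k =>
      mul_nonneg (dgauss_nonneg (Real.sqrt_pos.2 hρ0) _ _) (sq_nonneg _)
  have e0 := integral_fXbarYbar hb hρ0 hρ1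
  have e2 := integral_fXbarYbar_mul_quadratic hb hρ0 hρ1
  have i0 : Integrable fun p : ℝ × ℝ => fXbarYbar ρ b p.1 p.2 :=
    Integrable.of_integral_ne_zero (by rw [e0]; exact one_ne_zero)
  have i2 : Integrable fun p : ℝ × ℝ =>
      fXbarYbar ρ b p.1 p.2 * (p.1 ^ 2 + p.2 ^ 2 - 2 * ρ * p.1 * p.2) :=
    Integrable.of_integral_ne_zero (by
      rw [e2]
      have : 0 < 1 - ρ := sub_pos.2 hρ1
      positivity)
  have i01 : Integrable fun p : ℝ × ℝ =>
      fXbarYbar ρ b p.1 p.2 * Real.log (fXbarYbar ρ b p.1 p.2) +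
        Real.log (2 * π * √(1 - ρ ^ 2)) * fXbarYbar ρ b p.1 p.2 :=
    hEnt.add (i0.const_mul _)
  have hpt (p : ℝ × ℝ) :
      fXbarYbar ρ b p.1 p.2 * Real.log (fXbarYbar ρ b p.1 p.2 / fXY ρ p.1 p.2) =
        fXbarYbar ρ b p.1 p.2 * Real.log (fXbarYbar ρ b p.1 p.2) +
          Real.log (2 * π * √(1 - ρ ^ 2)) * fXbarYbar ρ b p.1 p.2 +
          (2 * (1 - ρ ^ 2))⁻¹ *
            (fXbarYbar ρ b p.1 p.2 * (p.1 ^ 2 + p.2 ^ 2 - 2 * ρ * p.1 * p.2)) := by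
    rcases eq_or_ne (fXbarYbar ρ b p.1 p.2) 0 with h | h
    · simp [h]
    · rw [Real.log_div h (fXY_pos hρ0 hρ1 _ _).ne', log_fXY hρ0 hρ1]
      ring
  simp only [hpt]
  rw [integral_add i01 (i2.const_mul _),
    integral_add hEnt (i0.const_mul _), integral_const_mul, integral_const_mul, e0, e2]
  have h1 : 1 - ρ ≠ 0 := (sub_pos.2 hρ1).ne'
  have h2 : 1 + ρ ≠ 0 := by positivity
  generalize ∑' k : ℤ, dgauss b (√ρ) k * (b * k) ^ 2 = m
  generalize Real.log (2 * π * √(1 - ρ ^ 2)) = L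
  rw [show 1 - ρ ^ 2 = (1 - ρ) * (1 + ρ) by ring]
  field_simp
  ring
end

section
/- (Lemma 2, first part.) Let L ≥ 1 be an integer, 0 < ρ < 1, and ε = ε_Λ(√(ρ(1−ρ)/(1+(L−1)ρ))). If ε < 1/2, then the L¹ (variation) distance between the L-variate mixture density and the L-variate Gaussian density with covariance K_L is bounded as ∫_{ℝ^L} |f_{X̄_L}(x) − f_{X_L}(x)| dx ≤ 4ε. -/
open Real Matrix

/-- The `L×L` covariance matrix with unit diagonal and off-diagonal entries `ρ`. -/
def KL (L : ℕ) (ρ : ℝ) : Matrix (Fin L) (Fin L) ℝ :=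
  Matrix.of fun i j => if i = j then (1 : ℝ) else ρ

/-- The centered `L`-variate Gaussian density with covariance matrix `K_L`. -/
noncomputable def fXL (L : ℕ) (ρ : ℝ) (x : Fin L → ℝ) : ℝ :=
  (1 / Real.sqrt ((2 * Real.pi) ^ L * (KL L ρ).det)) *
    Real.exp (-(1 / 2) * (x ⬝ᵥ ((KL L ρ)⁻¹ *ᵥ x)))

/-- The density of `X̄ᵢ = W̄ + √(1-ρ)Nᵢ`, `i = 1,…,L`, with `W̄ ~ D_{Λ,√ρ}`, `Λ = bℤ`. -/
noncomputable def fXbarL (L : ℕ) (ρ b : ℝ) (x : Fin L → ℝ) : ℝ :=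
  ∑' k : ℤ, dgauss b (Real.sqrt ρ) k * ∏ i, gpdf (Real.sqrt (1 - ρ)) (x i - b * k)

open MeasureTheory ProbabilityTheory

lemma gpdf_pos_s10 {σ : ℝ} (hσ : 0 < σ) (x : ℝ) : 0 < gpdf σ x := by
  unfold gpdf; positivity

lemma gpdf_neg (σ x : ℝ) : gpdf σ (-x) = gpdf σ x := by
  simp [gpdf]

lemma gpdf_sub_comm (σ x y : ℝ) : gpdf σ (x - y) = gpdf σ (y - x) := by
  rw [← gpdf_neg, neg_sub]

@[fun_prop]
lemma continuous_gpdf (σ : ℝ) : Continuous (gpdf σ) := by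
  unfold gpdf; fun_prop

lemma gpdf_sub_eq_gaussianPDFReal_s10 {σ : ℝ} (hσ : 0 < σ) (a x : ℝ) :
    gpdf σ (x - a) = gaussianPDFReal a (Real.toNNReal (σ ^ 2)) x := by
  rw [gpdf, gaussianPDFReal_def, Real.coe_toNNReal _ (sq_nonneg σ),
    Real.sqrt_mul (by positivity : 0 ≤ 2 * Real.pi), Real.sqrt_sq hσ.le, one_div]

lemma integrable_gpdf_sub {σ : ℝ} (hσ : 0 < σ) (a : ℝ) :
    Integrable fun x => gpdf σ (x - a) := by
  simp_rw [gpdf_sub_eq_gaussianPDFReal_s10 hσ]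
  exact integrable_gaussianPDFReal _ _

lemma integral_gpdf_sub_s10 {σ : ℝ} (hσ : 0 < σ) (a : ℝ) :
    ∫ x, gpdf σ (x - a) = 1 := by
  simp_rw [gpdf_sub_eq_gaussianPDFReal_s10 hσ]
  exact integral_gaussianPDFReal_eq_one _ (by simpa using hσ.ne')

lemma summable_exp_neg_mul_int_sq {c : ℝ} (hc : 0 < c) :
    Summable fun k : ℤ => Real.exp (-(c * (k : ℝ) ^ 2)) := by
  have h : Summable fun n : ℕ => Real.exp (-(c * (n : ℝ) ^ 2)) := by
    have hgeom : Summable fun n : ℕ => Real.exp (n * (-c)) :=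
      Real.summable_exp_nat_mul_iff.2 (by linarith)
    refine hgeom.of_nonneg_of_le (fun _ => (Real.exp_pos _).le) fun n => ?_
    refine Real.exp_le_exp.2 ?_
    have hn : (n : ℝ) ≤ (n : ℝ) ^ 2 := by exact_mod_cast Nat.le_self_pow two_ne_zero n
    nlinarith
  exact Summable.of_nat_of_neg (by simpa using h) (by simpa using h)

/-- A summable majorant, locally uniform in `x`, of the terms of a periodized Gaussian. -/
lemma gpdf_sub_le {σ : ℝ} (hσ : 0 < σ) (b x : ℝ) (k : ℤ) :
    gpdf σ (x - b * k) ≤ (1 / (Real.sqrt (2 * Real.pi) * σ)) *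
      (Real.exp (x ^ 2 / (2 * σ ^ 2)) * Real.exp (-(b ^ 2 / (4 * σ ^ 2) * (k : ℝ) ^ 2))) := by
  rw [gpdf, ← Real.exp_add]
  gcongr
  have h : x ^ 2 / (2 * σ ^ 2) + -(b ^ 2 / (4 * σ ^ 2) * (k : ℝ) ^ 2) -
      -(x - b * k) ^ 2 / (2 * σ ^ 2) = (2 * x - b * k) ^ 2 / (4 * σ ^ 2) := by
    field_simp; ring
  have : 0 ≤ (2 * x - b * k) ^ 2 / (4 * σ ^ 2) := by positivity
  linarith

lemma summable_gpdf_sub {σ b : ℝ} (hσ : 0 < σ) (hb : 0 < b) (x : ℝ) :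
    Summable fun k : ℤ => gpdf σ (x - b * k) :=
  (((summable_exp_neg_mul_int_sq (c := b ^ 2 / (4 * σ ^ 2)) (by positivity)).mul_left _).mul_left
    _).of_nonneg_of_le (fun _ => (gpdf_pos_s10 hσ _).le) (gpdf_sub_le hσ b x)

lemma bddAbove_flatness {σ b : ℝ} (hσ : 0 < σ) (hb : 0 < b) :
    BddAbove (Set.range fun x : ℝ => |b * (∑' k : ℤ, gpdf σ (x - b * k)) - 1|) := by
  have hs := summable_exp_neg_mul_int_sq (c := b ^ 2 / (4 * σ ^ 2)) (by positivity)
  refine ⟨b * ((1 / (Real.sqrt (2 * Real.pi) * σ)) * (Real.exp (b ^ 2 / (2 * σ ^ 2)) *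
    ∑' k : ℤ, Real.exp (-(b ^ 2 / (4 * σ ^ 2) * (k : ℝ) ^ 2)))) + 1, ?_⟩
  rintro _ ⟨x, rfl⟩
  set y := x - b * ⌊x / b⌋ with hy
  have hy0 : 0 ≤ y := by
    have := (le_div_iff₀ hb).1 (Int.floor_le (x / b))
    rw [hy]; linarith
  have hyb : y ≤ b := by
    have := (div_lt_iff₀ hb).1 (Int.lt_floor_add_one (x / b))
    rw [hy]; linarith
  have hshift : ∑' k : ℤ, gpdf σ (x - b * k) = ∑' k : ℤ, gpdf σ (y - b * k) := by
    rw [← (Equiv.addRight ⌊x / b⌋).tsum_eq]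
    refine tsum_congr fun k => ?_
    rw [hy, Equiv.coe_addRight]
    push_cast
    ring_nf
  have hle : ∑' k : ℤ, gpdf σ (y - b * k) ≤ (1 / (Real.sqrt (2 * Real.pi) * σ)) *
      (Real.exp (b ^ 2 / (2 * σ ^ 2)) *
        ∑' k : ℤ, Real.exp (-(b ^ 2 / (4 * σ ^ 2) * (k : ℝ) ^ 2))) := by
    rw [← tsum_mul_left, ← tsum_mul_left]
    refine (summable_gpdf_sub hσ hb y).tsum_le_tsum (fun k => (gpdf_sub_le hσ b y k).trans ?_)
      ((hs.mul_left _).mul_left _)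
    gcongr
  have hnn : 0 ≤ ∑' k : ℤ, gpdf σ (y - b * k) := tsum_nonneg fun _ => (gpdf_pos_s10 hσ _).le
  have := mul_le_mul_of_nonneg_left hle hb.le
  have := mul_nonneg hb.le hnn
  simp only [hshift]
  rw [abs_le]
  constructor <;> linarith

lemma abs_periodization_sub_one_le_flatness {σ b : ℝ} (hσ : 0 < σ) (hb : 0 < b) (x : ℝ) :
    |b * (∑' k : ℤ, gpdf σ (x - b * k)) - 1| ≤ flatness b σ :=
  le_ciSup (bddAbove_flatness hσ hb) x

section Gaussian

variable {L : ℕ} {ρ : ℝ}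

lemma one_add_natCast_sub_one_mul_pos (hρ0 : 0 < ρ) (hρ1 : ρ < 1) :
    0 < 1 + ((L : ℝ) - 1) * ρ := by
  have : 0 ≤ (L : ℝ) * ρ := by positivity
  linarith

lemma KL_eq_smul (hρ1 : ρ < 1) :
    KL L ρ = (1 - ρ) • (1 + replicateCol Unit (fun _ => ρ / (1 - ρ)) *
      replicateRow Unit fun _ : Fin L => (1 : ℝ)) := by
  have h : 1 - ρ ≠ 0 := by linarith
  ext i j
  simp only [KL, of_apply, Matrix.smul_apply, Matrix.add_apply, one_apply, mul_apply, replicateCol_apply,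
    replicateRow_apply, Finset.univ_unique, Finset.sum_singleton, smul_eq_mul]
  split_ifs <;> field_simp <;> ring

lemma det_KL_mul (hρ1 : ρ < 1) :
    (1 - ρ) * (KL L ρ).det = (1 - ρ) ^ L * (1 + ((L : ℝ) - 1) * ρ) := by
  have h : 1 - ρ ≠ 0 := by linarith
  rw [KL_eq_smul hρ1, det_smul, det_one_add_replicateCol_mul_replicateRow]
  simp only [dotProduct, one_mul, Finset.sum_const, Finset.card_univ, Fintype.card_fin,
    nsmul_eq_mul]
  field_simp
  ring

lemma inv_KL (hρ0 : 0 < ρ) (hρ1 : ρ < 1) :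
    (KL L ρ)⁻¹ = of fun i j =>
      ((if i = j then 1 else 0) - ρ / (1 + ((L : ℝ) - 1) * ρ)) / (1 - ρ) := by
  have h : 1 - ρ ≠ 0 := by linarith
  have hD := (one_add_natCast_sub_one_mul_pos (L := L) hρ0 hρ1).ne'
  refine inv_eq_right_inv ?_
  have hK : ∀ i j : Fin L, KL L ρ i j = (1 - ρ) * (if i = j then 1 else 0) + ρ := by
    intro i j
    simp only [KL, of_apply]
    split_ifs <;> ring
  ext i j
  simp only [mul_apply, hK, of_apply, one_apply]
  have hsum : ∀ k : Fin L, ((1 - ρ) * (if i = k then (1 : ℝ) else 0) + ρ) *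
      (((if k = j then 1 else 0) - ρ / (1 + ((L : ℝ) - 1) * ρ)) / (1 - ρ)) =
      (if i = k then ((if k = j then 1 else 0) - ρ / (1 + ((L : ℝ) - 1) * ρ)) else 0) +
      (ρ / (1 - ρ)) * (if k = j then 1 else 0) -
      ρ / (1 - ρ) * (ρ / (1 + ((L : ℝ) - 1) * ρ)) := by
    intro k
    split_ifs <;> field_simp <;> ring
  simp only [hsum, Finset.sum_sub_distrib, Finset.sum_add_distrib, ← Finset.mul_sum,
    Finset.sum_ite_eq, Finset.sum_ite_eq', Finset.mem_univ, if_true, Finset.sum_const,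
    Finset.card_univ, Fintype.card_fin, nsmul_eq_mul]
  obtain ⟨D, hDL⟩ : ∃ D, D = 1 + ((L : ℝ) - 1) * ρ := ⟨_, rfl⟩
  rw [← hDL] at hD ⊢
  split_ifs
  · field_simp
    linear_combination ρ * hDL
  · field_simp
    linear_combination ρ * hDL

lemma dotProduct_inv_KL_mulVec (hρ0 : 0 < ρ) (hρ1 : ρ < 1) (x : Fin L → ℝ) :
    x ⬝ᵥ ((KL L ρ)⁻¹ *ᵥ x) =
      (∑ i, x i ^ 2 - ρ / (1 + ((L : ℝ) - 1) * ρ) * (∑ i, x i) ^ 2) / (1 - ρ) := by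
  have h : ∀ i, ((KL L ρ)⁻¹ *ᵥ x) i =
      (x i - ρ / (1 + ((L : ℝ) - 1) * ρ) * ∑ j, x j) / (1 - ρ) := by
    intro i
    simp only [inv_KL hρ0 hρ1, mulVec, dotProduct, of_apply, div_mul_eq_mul_div,
      ← Finset.sum_div, sub_mul, Finset.sum_sub_distrib, ← Finset.mul_sum, ite_mul, one_mul,
      zero_mul, Finset.sum_ite_eq, Finset.mem_univ, if_true]
  simp only [dotProduct, h, mul_div_assoc', ← Finset.sum_div, mul_sub, Finset.sum_sub_distrib]
  congr 2
  · simp [sq]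
  · rw [← Finset.sum_mul]; ring

lemma fXL_nonneg (x : Fin L → ℝ) : 0 ≤ fXL L ρ x := by
  unfold fXL; positivity

/-- Completing the square: the joint density of `(W, X₁, …, X_L)` factors as the density of
`(X₁, …, X_L)` times the conditional density of `W`. -/
lemma gpdf_mul_prod_gpdf_eq (hρ0 : 0 < ρ) (hρ1 : ρ < 1) (x : Fin L → ℝ) (a : ℝ) :
    gpdf (Real.sqrt ρ) a * ∏ i, gpdf (Real.sqrt (1 - ρ)) (x i - a) =
      fXL L ρ x * gpdf (Real.sqrt (ρ * (1 - ρ) / (1 + ((L : ℝ) - 1) * ρ)))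
        (ρ * (∑ i, x i) / (1 + ((L : ℝ) - 1) * ρ) - a) := by
  have h : 0 < 1 - ρ := by linarith
  have hD := one_add_natCast_sub_one_mul_pos (L := L) hρ0 hρ1
  have hdet := det_KL_mul (L := L) hρ1
  have hdetpos : 0 < (KL L ρ).det :=
    pos_of_mul_pos_right (a := 1 - ρ) (by rw [hdet]; positivity) h.le
  have hprod : ∏ i, gpdf (Real.sqrt (1 - ρ)) (x i - a) =
      (1 / (Real.sqrt (2 * Real.pi) * Real.sqrt (1 - ρ))) ^ L *
        Real.exp (-(∑ i, x i ^ 2 - 2 * a * ∑ i, x i + L * a ^ 2) / (2 * (1 - ρ))) := by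
    simp only [gpdf, Finset.prod_mul_distrib, Finset.prod_const, Finset.card_univ,
      Fintype.card_fin, ← Real.exp_sum, Real.sq_sqrt h.le]
    congr 2
    rw [← Finset.sum_div, Finset.sum_neg_distrib]
    congr 2
    simp only [sub_sq, Finset.sum_add_distrib, Finset.sum_sub_distrib, Finset.sum_const,
      Finset.card_univ, Fintype.card_fin, nsmul_eq_mul, Finset.mul_sum]
    congr 2
    exact Finset.sum_congr rfl fun i _ => by ring
  have hconst : 1 / (Real.sqrt (2 * Real.pi) * Real.sqrt ρ) *
      (1 / (Real.sqrt (2 * Real.pi) * Real.sqrt (1 - ρ))) ^ L =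
      1 / Real.sqrt ((2 * Real.pi) ^ L * (KL L ρ).det) *
      (1 / (Real.sqrt (2 * Real.pi) *
        Real.sqrt (ρ * (1 - ρ) / (1 + ((L : ℝ) - 1) * ρ)))) := by
    have hpow : ∀ y : ℝ, 0 ≤ y → Real.sqrt y ^ L = Real.sqrt (y ^ L) := by
      intro y hy
      rw [eq_comm, Real.sqrt_eq_iff_mul_self_eq (by positivity) (by positivity), ← mul_pow,
        Real.mul_self_sqrt hy]
    rw [div_pow, one_pow, ← Real.sqrt_mul (by positivity), ← Real.sqrt_mul (by positivity),
      ← Real.sqrt_mul (by positivity), hpow _ (by positivity), one_div_mul_one_div,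
      one_div_mul_one_div, ← Real.sqrt_mul (by positivity), ← Real.sqrt_mul (by positivity)]
    congr 2
    have : (KL L ρ).det * (ρ * (1 - ρ) / (1 + ((L : ℝ) - 1) * ρ)) = ρ * (1 - ρ) ^ L := by
      rw [mul_div_assoc', div_eq_iff hD.ne']
      linear_combination ρ * hdet
    rw [mul_pow]
    linear_combination -(2 * Real.pi) * (2 * Real.pi) ^ L * this
  rw [hprod, fXL, dotProduct_inv_KL_mulVec hρ0 hρ1, gpdf, gpdf, Real.sq_sqrt hρ0.le,
    Real.sq_sqrt (by positivity), mul_mul_mul_comm, hconst,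
    mul_mul_mul_comm (1 / Real.sqrt ((2 * Real.pi) ^ L * (KL L ρ).det)) (Real.exp (-(1 / 2) * _)), ← Real.exp_add,
    ← Real.exp_add]
  congr 2
  generalize (∑ i, x i) = s
  generalize (∑ i, x i ^ 2) = q
  obtain ⟨D, hDL⟩ : ∃ D, D = 1 + ((L : ℝ) - 1) * ρ := ⟨_, rfl⟩
  rw [← hDL] at hD ⊢
  have hexp : -a ^ 2 / (2 * ρ) + -(q - 2 * a * s + L * a ^ 2) / (2 * (1 - ρ)) -
      (-(1 / 2) * ((q - ρ / D * s ^ 2) / (1 - ρ)) +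
        -(ρ * s / D - a) ^ 2 / (2 * (ρ * (1 - ρ) / D))) =
      a ^ 2 / (2 * ρ * (1 - ρ)) * (D - (1 + ((L : ℝ) - 1) * ρ)) := by
    field_simp
    ring
  rw [← hDL, sub_self, mul_zero] at hexp
  linarith

lemma integrable_prod_gpdf_sub {σ : ℝ} (hσ : 0 < σ) (a : ℝ) :
    Integrable fun x : Fin L → ℝ => ∏ i, gpdf σ (x i - a) :=
  Integrable.fintype_prod fun _ => integrable_gpdf_sub hσ a

lemma integral_prod_gpdf_sub {σ : ℝ} (hσ : 0 < σ) (a : ℝ) :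
    ∫ x : Fin L → ℝ, ∏ i, gpdf σ (x i - a) = 1 := by
  rw [integral_fintype_prod_volume_eq_pow (fun y => gpdf σ (y - a)), integral_gpdf_sub_s10 hσ, one_pow]

lemma integrable_gpdf_mul_prod_gpdf (hρ0 : 0 < ρ) (hρ1 : ρ < 1) :
    Integrable (Function.uncurry fun (a : ℝ) (x : Fin L → ℝ) =>
      gpdf (Real.sqrt ρ) a * ∏ i, gpdf (Real.sqrt (1 - ρ)) (x i - a)) (volume.prod volume) := by
  have h : 0 < Real.sqrt (1 - ρ) := Real.sqrt_pos.2 (by linarith)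
  have hρ : 0 < Real.sqrt ρ := Real.sqrt_pos.2 hρ0
  have hcont : Continuous (Function.uncurry fun (a : ℝ) (x : Fin L → ℝ) =>
      gpdf (Real.sqrt ρ) a * ∏ i, gpdf (Real.sqrt (1 - ρ)) (x i - a)) := by
    unfold Function.uncurry
    fun_prop
  rw [integrable_prod_iff hcont.aestronglyMeasurable]
  refine ⟨.of_forall fun a => (integrable_prod_gpdf_sub h a).const_mul (gpdf _ a), ?_⟩
  have hnorm : ∀ (a : ℝ) (x : Fin L → ℝ),
      ‖gpdf (Real.sqrt ρ) a * ∏ i, gpdf (Real.sqrt (1 - ρ)) (x i - a)‖ =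
      gpdf (Real.sqrt ρ) a * ∏ i, gpdf (Real.sqrt (1 - ρ)) (x i - a) := fun a x =>
    Real.norm_of_nonneg (mul_nonneg (gpdf_pos_s10 hρ _).le
      (Finset.prod_nonneg fun _ _ => (gpdf_pos_s10 h _).le))
  simp only [Function.uncurry_apply_pair, hnorm, integral_const_mul, integral_prod_gpdf_sub h,
    mul_one]
  simpa using integrable_gpdf_sub hρ 0

lemma integral_gpdf_mul_prod_gpdf (hρ0 : 0 < ρ) (hρ1 : ρ < 1) (x : Fin L → ℝ) :
    ∫ a, gpdf (Real.sqrt ρ) a * ∏ i, gpdf (Real.sqrt (1 - ρ)) (x i - a) = fXL L ρ x := by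
  have hD := one_add_natCast_sub_one_mul_pos (L := L) hρ0 hρ1
  have h : 0 < 1 - ρ := by linarith
  simp_rw [gpdf_mul_prod_gpdf_eq hρ0 hρ1, gpdf_sub_comm _ (_ / _)]
  rw [integral_const_mul, integral_gpdf_sub_s10 (Real.sqrt_pos.2 (by positivity)), mul_one]

lemma integrable_fXL (hρ0 : 0 < ρ) (hρ1 : ρ < 1) : Integrable (fXL L ρ) := by
  have := (integrable_gpdf_mul_prod_gpdf (L := L) hρ0 hρ1).integral_prod_right
  simpa only [Function.uncurry_apply_pair, integral_gpdf_mul_prod_gpdf hρ0 hρ1] using this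

lemma integral_fXL (hρ0 : 0 < ρ) (hρ1 : ρ < 1) : ∫ x, fXL L ρ x = 1 := by
  have h : 0 < Real.sqrt (1 - ρ) := Real.sqrt_pos.2 (by linarith)
  simp_rw [← integral_gpdf_mul_prod_gpdf hρ0 hρ1]
  rw [← integral_integral_swap (integrable_gpdf_mul_prod_gpdf (L := L) hρ0 hρ1)]
  simp only [integral_const_mul, integral_prod_gpdf_sub h, mul_one]
  simpa using integral_gpdf_sub_s10 (Real.sqrt_pos.2 hρ0) 0

/-- The lattice mass of the Gaussian of variance `ρ` is an average of periodizations of the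
conditional Gaussian. -/
lemma integrable_and_integral_fXL_mul_periodization {b : ℝ} (hb : 0 < b) (hρ0 : 0 < ρ) (hρ1 : ρ < 1) :
    Integrable (fun x : Fin L → ℝ => fXL L ρ x *
        (b * ∑' k : ℤ, gpdf (Real.sqrt (ρ * (1 - ρ) / (1 + ((L : ℝ) - 1) * ρ)))
          (ρ * (∑ i, x i) / (1 + ((L : ℝ) - 1) * ρ) - b * k))) ∧
      ∫ x : Fin L → ℝ, fXL L ρ x *
        (b * ∑' k : ℤ, gpdf (Real.sqrt (ρ * (1 - ρ) / (1 + ((L : ℝ) - 1) * ρ)))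
          (ρ * (∑ i, x i) / (1 + ((L : ℝ) - 1) * ρ) - b * k)) =
      b * ∑' k : ℤ, gpdf (Real.sqrt ρ) (b * k) := by
  have h : 0 < 1 - ρ := by linarith
  have hσ : 0 < Real.sqrt (1 - ρ) := Real.sqrt_pos.2 h
  have hρ : 0 < Real.sqrt ρ := Real.sqrt_pos.2 hρ0
  have hD := one_add_natCast_sub_one_mul_pos (L := L) hρ0 hρ1
  have hτ : 0 < Real.sqrt (ρ * (1 - ρ) / (1 + ((L : ℝ) - 1) * ρ)) :=
    Real.sqrt_pos.2 (by positivity)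
  set τ := Real.sqrt (ρ * (1 - ρ) / (1 + ((L : ℝ) - 1) * ρ))
  set m : (Fin L → ℝ) → ℝ := fun x => ρ * (∑ i, x i) / (1 + ((L : ℝ) - 1) * ρ) with hm
  have hmeas : Measurable fun x : Fin L → ℝ => ∑' k : ℤ, gpdf τ (m x - b * k) :=
    Measurable.tsum fun k => Continuous.measurable (by fun_prop)
  constructor
  · refine ((integrable_fXL hρ0 hρ1).mul_const (1 + flatness b τ)).mono'
      ((integrable_fXL hρ0 hρ1).aestronglyMeasurable.mul
        (hmeas.const_mul b).aestronglyMeasurable) (.of_forall fun x => ?_)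
    rw [norm_mul, Real.norm_of_nonneg (fXL_nonneg x)]
    refine mul_le_mul_of_nonneg_left ?_ (fXL_nonneg x)
    have hA := abs_le.1 (abs_periodization_sub_one_le_flatness hτ hb (m x))
    rw [Real.norm_of_nonneg (mul_nonneg hb.le (tsum_nonneg fun _ => (gpdf_pos_s10 hτ _).le))]
    linarith [hA.2]
  · have hint : ∀ k : ℤ, ∫ x : Fin L → ℝ,
        gpdf (Real.sqrt ρ) (b * k) * ∏ i, gpdf (Real.sqrt (1 - ρ)) (x i - b * k) =
        gpdf (Real.sqrt ρ) (b * k) := fun k => by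
      rw [integral_const_mul, integral_prod_gpdf_sub hσ, mul_one]
    have hsum : Summable fun k : ℤ => gpdf (Real.sqrt ρ) (b * k) := by
      simpa [gpdf_neg] using summable_gpdf_sub hρ hb 0
    have hswap := integral_tsum_of_summable_integral_norm (μ := (volume : Measure (Fin L → ℝ)))
      (F := fun (k : ℤ) x =>
        gpdf (Real.sqrt ρ) (b * k) * ∏ i, gpdf (Real.sqrt (1 - ρ)) (x i - b * k))
      (fun k => (integrable_prod_gpdf_sub hσ _).const_mul _) (by
        refine hsum.congr fun k => ?_
        refine (hint k).symm.trans ?_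
        exact integral_congr_ae (.of_forall fun x => (Real.norm_of_nonneg
          (mul_nonneg (gpdf_pos_s10 hρ _).le
            (Finset.prod_nonneg fun _ _ => (gpdf_pos_s10 hσ _).le))).symm))
    simp only [hint] at hswap
    rw [hswap, ← integral_const_mul]
    refine integral_congr_ae (.of_forall fun x => ?_)
    simp only [gpdf_mul_prod_gpdf_eq hρ0 hρ1, tsum_mul_left]
    ring

lemma abs_lattice_mass_sub_one_le {b : ℝ} (L : ℕ) (hb : 0 < b) (hρ0 : 0 < ρ) (hρ1 : ρ < 1) :
    |b * ∑' k : ℤ, gpdf (Real.sqrt ρ) (b * k) - 1| ≤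
      flatness b (Real.sqrt (ρ * (1 - ρ) / (1 + ((L : ℝ) - 1) * ρ))) := by
  have h : 0 < 1 - ρ := by linarith
  have hD := one_add_natCast_sub_one_mul_pos (L := L) hρ0 hρ1
  have hτ : 0 < Real.sqrt (ρ * (1 - ρ) / (1 + ((L : ℝ) - 1) * ρ)) :=
    Real.sqrt_pos.2 (by positivity)
  obtain ⟨hI, hE⟩ := integrable_and_integral_fXL_mul_periodization (L := L) hb hρ0 hρ1
  have hf := integrable_fXL (L := L) hρ0 hρ1
  have hsub := integral_sub hI hf
  rw [hE, integral_fXL hρ0 hρ1] at hsub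
  rw [← hsub, ← Real.norm_eq_abs]
  refine (norm_integral_le_of_norm_le (hf.mul_const _) (.of_forall fun x => ?_)).trans_eq
    (by rw [integral_mul_const, integral_fXL hρ0 hρ1, one_mul])
  rw [← mul_sub_one, norm_mul, Real.norm_of_nonneg (fXL_nonneg x), Real.norm_eq_abs]
  exact mul_le_mul_of_nonneg_left (abs_periodization_sub_one_le_flatness hτ hb _) (fXL_nonneg x)

lemma fXbarL_eq {b : ℝ} (hb : 0 < b) (hρ0 : 0 < ρ) (hρ1 : ρ < 1) (x : Fin L → ℝ) :
    fXbarL L ρ b x = fXL L ρ x *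
      ((b * ∑' k : ℤ, gpdf (Real.sqrt (ρ * (1 - ρ) / (1 + ((L : ℝ) - 1) * ρ)))
          (ρ * (∑ i, x i) / (1 + ((L : ℝ) - 1) * ρ) - b * k)) /
        (b * ∑' k : ℤ, gpdf (Real.sqrt ρ) (b * k))) := by
  rw [mul_div_mul_left _ _ hb.ne', fXbarL, ← mul_div_assoc, ← tsum_mul_left, ← tsum_div_const]
  refine tsum_congr fun k => ?_
  rw [dgauss, div_mul_eq_mul_div, gpdf_mul_prod_gpdf_eq hρ0 hρ1]

end Gaussian

/-- Lemma 2, first part: if `ε = ε_Λ(√(ρ(1-ρ)/(1+(L-1)ρ))) < 1/2`, the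
L¹ (variation) distance between the `L`-variate mixture density and the `L`-variate
Gaussian density with covariance `K_L` is at most `4ε`. -/
theorem multivariate_variation_distance_le (L : ℕ) (hL : 1 ≤ L) (ρ b : ℝ) (hb : 0 < b)
    (hρ0 : 0 < ρ) (hρ1 : ρ < 1)
    (hε : flatness b (Real.sqrt (ρ * (1 - ρ) / (1 + ((L : ℝ) - 1) * ρ))) < 1 / 2) :
    ∫ x : Fin L → ℝ, |fXbarL L ρ b x - fXL L ρ x| ≤
      4 * flatness b (Real.sqrt (ρ * (1 - ρ) / (1 + ((L : ℝ) - 1) * ρ))) := by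
  have h : 0 < 1 - ρ := by linarith
  have hD := one_add_natCast_sub_one_mul_pos (L := L) hρ0 hρ1
  have hτ : 0 < Real.sqrt (ρ * (1 - ρ) / (1 + ((L : ℝ) - 1) * ρ)) :=
    Real.sqrt_pos.2 (by positivity)
  have hB := abs_le.1 (abs_lattice_mass_sub_one_le L hb hρ0 hρ1)
  set ε := flatness b (Real.sqrt (ρ * (1 - ρ) / (1 + ((L : ℝ) - 1) * ρ)))
  have hf := integrable_fXL (L := L) hρ0 hρ1
  refine (integral_mono_of_nonneg (.of_forall fun _ => abs_nonneg _) (hf.mul_const (4 * ε))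
    (.of_forall fun x => ?_)).trans_eq (by rw [integral_mul_const, integral_fXL hρ0 hρ1, one_mul])
  have hA := abs_le.1 (abs_periodization_sub_one_le_flatness hτ hb
    (ρ * (∑ i, x i) / (1 + ((L : ℝ) - 1) * ρ)))
  simp only [fXbarL_eq hb hρ0 hρ1]
  rw [← mul_sub_one, abs_mul, abs_of_nonneg (fXL_nonneg x)]
  refine mul_le_mul_of_nonneg_left ?_ (fXL_nonneg x)
  have hBpos : 0 < b * ∑' k : ℤ, gpdf (Real.sqrt ρ) (b * k) := by linarith [hB.1]
  have hε0 : 0 ≤ ε := by linarith [hB.1, hB.2]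
  rw [div_sub_one hBpos.ne', abs_div, abs_of_pos hBpos, div_le_iff₀ hBpos, abs_le]
  constructor <;> nlinarith [hA.1, hA.2, hB.1, hB.2]
end
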